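/- Let k ≥ 2 and 1 ≤ p ≤ h with h ≥ 2 be integers, let λ be a real number, and let X′ be the (k−1)p × h real matrix each of whose rows equals (−1, …, −1, 1, …, 1) with h − p entries −1 followed by p entries 1. Then X′ · adj((1 − λ)·I_h − J_h) · X′ᵀ = ( h·(1 − λ)^(h−2)(1 − λ − h) + (2p − h)²·(1 − λ)^(h−2) ) · J_{(k−1)p}. -/

import Mathlib

open Matrix

/-- The `(k−1)p × h` matrix each of whose rows is `h − p` entries `−1` followed by
`p` entries `1`. -/
def rowSignMat (k p h : ℕ) : Matrix (Fin ((k - 1) * p)) (Fin h) ℝ :=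
  Matrix.of fun _ j => if (j : ℕ) < h - p then -1 else 1

lemma aux_det (h : ℕ) (hh : 2 ≤ h) (a : ℝ) (ha : a ≠ 0) :
    (a • (1 : Matrix (Fin h) (Fin h) ℝ) - Matrix.of (fun _ _ => (1 : ℝ))).det
      = a ^ (h - 2) * (a * (a - h)) := by
  have e : a • (1 : Matrix (Fin h) (Fin h) ℝ) - Matrix.of (fun _ _ => (1 : ℝ))
      = a • (1 + replicateCol Unit (fun _ : Fin h => -a⁻¹) *
          replicateRow Unit (fun _ : Fin h => (1 : ℝ))) := by
    ext i j
    simp [Matrix.mul_apply, mul_add, ha]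
    ring
  rw [e, det_smul, det_one_add_replicateCol_mul_replicateRow]
  obtain ⟨m, rfl⟩ := Nat.exists_eq_add_of_le' hh
  simp [dotProduct]
  field_simp
  ring

lemma aux_J_sq (h : ℕ) : (Matrix.of (fun (_ _ : Fin h) => (1 : ℝ))) * Matrix.of (fun _ _ => (1 : ℝ))
    = (h : ℝ) • Matrix.of (fun (_ _ : Fin h) => (1 : ℝ)) := by
  ext i j
  simp [Matrix.mul_apply]

lemma aux_adj_generic (h : ℕ) (hh : 2 ≤ h) (a : ℝ) (ha : a ≠ 0) (hah : a ≠ h) :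
    (a • (1 : Matrix (Fin h) (Fin h) ℝ) - Matrix.of (fun _ _ => (1 : ℝ))).adjugate
      = a ^ (h - 2) • ((a - h) • (1 : Matrix (Fin h) (Fin h) ℝ)
        + Matrix.of (fun _ _ => (1 : ℝ))) := by
  have hJ := aux_J_sq h
  have hd := aux_det h hh a ha
  set J : Matrix (Fin h) (Fin h) ℝ := Matrix.of (fun _ _ => (1 : ℝ)) with hJdef
  have h1 : (a • (1 : Matrix (Fin h) (Fin h) ℝ) - J) * ((a - h) • 1 + J)
      = (a * (a - h)) • 1 := by
    simp only [sub_mul, mul_add, smul_mul_assoc, one_mul, mul_smul_comm, mul_one, hJ]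
    module
  have h2 := adjugate_mul (a • (1 : Matrix (Fin h) (Fin h) ℝ) - J)
  have h3 := congrArg (fun M => M * ((a - h) • 1 + J)) h2
  simp only [Matrix.mul_assoc, h1, hd, smul_mul_assoc, one_mul, mul_smul_comm, mul_one] at h3
  have hc : a * (a - h) ≠ 0 := mul_ne_zero ha (sub_ne_zero.2 hah)
  refine smul_right_injective _ hc ?_
  simp only
  rw [h3, mul_comm, mul_smul]

lemma aux_adj (h : ℕ) (hh : 2 ≤ h) (a : ℝ) :
    (a • (1 : Matrix (Fin h) (Fin h) ℝ) - Matrix.of (fun _ _ => (1 : ℝ))).adjugate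
      = a ^ (h - 2) • ((a - h) • (1 : Matrix (Fin h) (Fin h) ℝ)
        + Matrix.of (fun _ _ => (1 : ℝ))) := by
  have hdense : Dense (({0, (h : ℝ)} : Set ℝ)ᶜ) :=
    (Set.Finite.countable (Set.toFinite ({0, (h : ℝ)} : Set ℝ))).dense_compl ℝ
  have := Continuous.ext_on (f := fun a : ℝ =>
      (a • (1 : Matrix (Fin h) (Fin h) ℝ) - Matrix.of (fun _ _ => (1 : ℝ))).adjugate)
    (g := fun a : ℝ => a ^ (h - 2) • ((a - h) • (1 : Matrix (Fin h) (Fin h) ℝ)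
        + Matrix.of (fun _ _ => (1 : ℝ)))) hdense
    (Continuous.matrix_adjugate (by fun_prop)) (by fun_prop) (by
      intro x hx
      simp only [Set.mem_compl_iff, Set.mem_insert_iff, Set.mem_singleton_iff, not_or] at hx
      exact aux_adj_generic h hh x hx.1 hx.2)
  exact congrFun this a

lemma aux_sum (p h : ℕ) (hph : p ≤ h) :
    ∑ j : Fin h, (if (j : ℕ) < h - p then (-1 : ℝ) else 1) = 2 * p - h := by
  rw [Fin.sum_univ_eq_sum_range (fun j => if j < h - p then (-1 : ℝ) else 1) h]
  obtain ⟨q, rfl⟩ := Nat.exists_eq_add_of_le' hph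
  rw [Finset.sum_range_add, Finset.sum_congr rfl (g := fun _ => (-1 : ℝ))]
  · simp
    ring
  · intro x hx
    have hx' : x < q := by simpa using hx
    rw [if_pos (by omega)]

/-- `X′ · adj((1 − λ)I_h − J_h) · X′ᵀ
  = (h(1 − λ)^(h−2)(1 − λ − h) + (2p − h)²(1 − λ)^(h−2)) J`. -/
theorem rowSignMat_adjugate_transpose (k p h : ℕ) (hk : 2 ≤ k) (hp : 1 ≤ p) (hph : p ≤ h)
    (hh : 2 ≤ h) (lam : ℝ) :
    rowSignMat k p h *
        ((1 - lam) • (1 : Matrix (Fin h) (Fin h) ℝ)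
          - Matrix.of (fun (_ _ : Fin h) => (1 : ℝ))).adjugate
        * (rowSignMat k p h)ᵀ
      = ((h : ℝ) * (1 - lam) ^ (h - 2) * (1 - lam - h)
            + (2 * (p : ℝ) - h) ^ 2 * (1 - lam) ^ (h - 2)) •
          Matrix.of (fun (_ _ : Fin ((k - 1) * p)) => (1 : ℝ)) := by
  rw [aux_adj h hh]
  have hs := aux_sum p h hph
  have hR : rowSignMat k p h * (rowSignMat k p h)ᵀ
      = (h : ℝ) • Matrix.of (fun (_ _ : Fin ((k - 1) * p)) => (1 : ℝ)) := by
    ext i j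
    simp only [Matrix.mul_apply, rowSignMat, Matrix.of_apply, Matrix.transpose_apply,
      Matrix.smul_apply, smul_eq_mul, mul_one]
    rw [Finset.sum_congr rfl (g := fun _ => (1 : ℝ))]
    · simp
    · intro x _
      split_ifs <;> norm_num
  have hS : rowSignMat k p h * Matrix.of (fun (_ _ : Fin h) => (1 : ℝ)) * (rowSignMat k p h)ᵀ
      = ((2 * (p : ℝ) - h) ^ 2) • Matrix.of (fun (_ _ : Fin ((k - 1) * p)) => (1 : ℝ)) := by
    ext i j
    simp only [Matrix.mul_apply, rowSignMat, Matrix.of_apply, Matrix.transpose_apply,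
      Matrix.smul_apply, smul_eq_mul, mul_one, hs]
    rw [← Finset.mul_sum, hs, sq]
  simp only [Matrix.mul_smul, Matrix.smul_mul, Matrix.mul_add, Matrix.add_mul, Matrix.mul_one,
    hR, hS]
  module
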